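/- Let (Ω,u) be a minimal graph in ℝ³ supported on the open set Ω ⊆ ℝ² (so u is a smooth solution of div(∇u/√(1+|∇u|²)) = 0 with u ≥ 0 on Ω and u = 0 on ∂Ω), and let G = {(x,u(x)) : x ∈ Ω} ⊆ ℝ³. Then for every R > 0 the area of G inside the ball of radius R centered at the origin satisfies A(G ∩ B³(R)) ≤ 3πR², where A denotes two-dimensional Hausdorff measure and B³(R) = {p ∈ ℝ³ : |p| ≤ R}. -/

import Mathlib

open Real MeasureTheory ENNReal

noncomputable section

abbrev E2 := EuclideanSpace ℝ (Fin 2)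
abbrev E3 := EuclideanSpace ℝ (Fin 3)

/-- The divergence of the vector field `∇u/√(1+|∇u|²)` at the point `x`;
the minimal surface equation asserts that this vanishes. -/
def msDiv (u : E2 → ℝ) (x : E2) : ℝ :=
  ∑ i : Fin 2, fderiv ℝ (fun y => (Real.sqrt (1 + ‖gradient u y‖ ^ 2))⁻¹ * gradient u y i) x
    (EuclideanSpace.single i 1)

/-- The point `(x₁, x₂, t)` of `ℝ³` sitting over `x = (x₁,x₂) ∈ ℝ²`. -/
def toE3 (x : E2) (t : ℝ) : E3 := (EuclideanSpace.equiv (Fin 3) ℝ).symm ![x 0, x 1, t]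

open Set Filter Topology

/-- A `C¹` approximation of the positive part `t ↦ max t 0`. -/
def smoothPos (δ t : ℝ) : ℝ := ((max t 0) ^ 2 - (max (t - δ) 0) ^ 2) / (2 * δ)

/-- The derivative of `smoothPos δ`. -/
def smoothPosDeriv (δ t : ℝ) : ℝ := (max t 0 - max (t - δ) 0) / δ

lemma hasDerivAt_max_zero_sq (t : ℝ) :
    HasDerivAt (fun t : ℝ => (max t 0) ^ 2) (2 * max t 0) t := by
  rcases lt_trichotomy t 0 with h | h | h
  · have h1 : (fun t : ℝ => (max t 0) ^ 2) =ᶠ[𝓝 t] fun _ => 0 := by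
      filter_upwards [gt_mem_nhds h] with s hs
      simp [max_eq_right hs.le]
    rw [max_eq_right h.le, mul_zero]
    exact (hasDerivAt_const t (0 : ℝ)).congr_of_eventuallyEq h1
  · subst h
    rw [hasDerivAt_iff_isLittleO]
    simp only [max_self, sub_zero, mul_zero, smul_zero, ne_eq, OfNat.ofNat_ne_zero,
      not_false_eq_true, zero_pow]
    have h1 : (fun s : ℝ => (max s 0) ^ 2) =O[𝓝 0] fun s : ℝ => s ^ 2 := by
      refine Asymptotics.IsBigO.of_bound 1 (Eventually.of_forall fun s => ?_)
      rw [one_mul, Real.norm_of_nonneg (sq_nonneg _), Real.norm_of_nonneg (sq_nonneg _)]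
      rcases le_total s 0 with h | h
      · rw [max_eq_right h]
        nlinarith [sq_nonneg s]
      · rw [max_eq_left h]
    refine h1.trans_isLittleO ?_
    simpa using Asymptotics.isLittleO_pow_pow (𝕜 := ℝ) (show 1 < 2 by norm_num)
  · have h1 : (fun t : ℝ => (max t 0) ^ 2) =ᶠ[𝓝 t] fun t => t ^ 2 := by
      filter_upwards [lt_mem_nhds h] with s hs
      rw [max_eq_left (le_of_lt hs)]
    rw [max_eq_left h.le]
    have h2 := hasDerivAt_pow 2 t
    simp only [Nat.cast_ofNat, Nat.add_one_sub_one, pow_one] at h2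
    exact h2.congr_of_eventuallyEq h1

lemma hasDerivAt_smoothPos {δ : ℝ} (hδ : 0 < δ) (t : ℝ) :
    HasDerivAt (smoothPos δ) (smoothPosDeriv δ t) t := by
  have h1 := hasDerivAt_max_zero_sq t
  have h2 : HasDerivAt (fun t : ℝ => (max (t - δ) 0) ^ 2) (2 * max (t - δ) 0) t :=
    (hasDerivAt_max_zero_sq (t - δ)).comp_sub_const t δ
  have h3 := (h1.sub h2).div_const (2 * δ)
  refine h3.congr_deriv ?_
  unfold smoothPosDeriv
  field_simp

lemma continuous_smoothPosDeriv (δ : ℝ) : Continuous (smoothPosDeriv δ) := by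
  unfold smoothPosDeriv
  fun_prop

lemma contDiff_smoothPos {δ : ℝ} (hδ : 0 < δ) : ContDiff ℝ 1 (smoothPos δ) := by
  rw [contDiff_one_iff_deriv]
  refine ⟨fun t => (hasDerivAt_smoothPos hδ t).differentiableAt, ?_⟩
  have : deriv (smoothPos δ) = smoothPosDeriv δ :=
    funext fun t => (hasDerivAt_smoothPos hδ t).deriv
  rw [this]
  exact continuous_smoothPosDeriv δ

lemma smoothPos_of_nonpos {δ t : ℝ} (hδ : 0 < δ) (ht : t ≤ 0) : smoothPos δ t = 0 := by
  simp [smoothPos, max_eq_right ht, max_eq_right (show t - δ ≤ 0 by linarith)]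

lemma smoothPos_nonneg {δ : ℝ} (hδ : 0 < δ) (t : ℝ) : 0 ≤ smoothPos δ t := by
  have h : max (t - δ) 0 ≤ max t 0 := max_le_max (by linarith) le_rfl
  have h0 : 0 ≤ max (t - δ) 0 := le_max_right _ _
  unfold smoothPos
  apply div_nonneg _ (by linarith)
  nlinarith

lemma sub_le_smoothPos {δ : ℝ} (hδ : 0 < δ) (t : ℝ) : t - δ ≤ smoothPos δ t := by
  rcases le_total t δ with h | h
  · linarith [smoothPos_nonneg hδ t]
  · unfold smoothPos
    rw [max_eq_left (by linarith), max_eq_left (by linarith), le_div_iff₀ (by linarith)]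
    nlinarith

lemma smoothPosDeriv_of_nonpos {δ t : ℝ} (hδ : 0 < δ) (ht : t ≤ 0) : smoothPosDeriv δ t = 0 := by
  simp [smoothPosDeriv, max_eq_right ht, max_eq_right (show t - δ ≤ 0 by linarith)]

lemma smoothPosDeriv_of_ge {δ t : ℝ} (hδ : 0 < δ) (ht : δ ≤ t) : smoothPosDeriv δ t = 1 := by
  unfold smoothPosDeriv
  rw [max_eq_left (by linarith), max_eq_left (by linarith)]
  field_simp
  ring

lemma smoothPosDeriv_nonneg {δ : ℝ} (hδ : 0 < δ) (t : ℝ) : 0 ≤ smoothPosDeriv δ t :=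
  div_nonneg (sub_nonneg.2 (max_le_max (by linarith) le_rfl)) hδ.le

lemma monotone_smoothPosDeriv {δ : ℝ} (hδ : 0 < δ) : Monotone (smoothPosDeriv δ) := by
  intro s t hst
  unfold smoothPosDeriv
  apply div_le_div_of_nonneg_right _ hδ.le
  rcases le_total s 0 with h1 | h1 <;> rcases le_total t 0 with h2 | h2 <;>
  rcases le_total (s - δ) 0 with h3 | h3 <;> rcases le_total (t - δ) 0 with h4 | h4 <;>
  simp only [max_eq_left, max_eq_right, h1, h2, h3, h4] <;> linarith

lemma smoothPosDeriv_le_one {δ : ℝ} (hδ : 0 < δ) (t : ℝ) : smoothPosDeriv δ t ≤ 1 := by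
  rcases le_total t δ with h | h
  · exact (monotone_smoothPosDeriv hδ h).trans (smoothPosDeriv_of_ge hδ le_rfl).le
  · exact (smoothPosDeriv_of_ge hδ h).le

/-- The ellipse `{v | |v|² + ⟨g, v⟩² ≤ s²}` has area `π s² / √(1 + |g|²)`. -/
lemma volume_ellipse (g : E2) {s : ℝ} (hs : 0 ≤ s) :
    volume {v : E2 | ‖v‖ ^ 2 + (inner ℝ g v) ^ 2 ≤ s ^ 2} =
      ENNReal.ofReal (π * s ^ 2 * (√(1 + ‖g‖ ^ 2))⁻¹) := by
  set W := √(1 + ‖g‖ ^ 2) with hW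
  have hW2 : W ^ 2 = 1 + ‖g‖ ^ 2 := Real.sq_sqrt (by positivity)
  have hW0 : 0 < W := Real.sqrt_pos.2 (by positivity)
  let T : E2 →ₗ[ℝ] E2 := LinearMap.transvection (innerₛₗ ℝ g) ((W + 1)⁻¹ • g)
  have hdet : LinearMap.det T = W := by
    simp only [T, LinearMap.transvection.det, map_smul, innerₛₗ_apply_apply,
      real_inner_self_eq_norm_sq, smul_eq_mul]
    field_simp
    linarith
  have hT : ∀ v, ‖T v‖ ^ 2 = ‖v‖ ^ 2 + (inner ℝ g v) ^ 2 := by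
    intro v
    have : T v = v + (inner ℝ g v) • ((W + 1)⁻¹ • g) := rfl
    rw [this, norm_add_sq_real, norm_smul, norm_smul, inner_smul_right, inner_smul_right,
      real_inner_comm, mul_pow, mul_pow, Real.norm_eq_abs, Real.norm_eq_abs, sq_abs, sq_abs]
    have hg : ‖g‖ ^ 2 = W ^ 2 - 1 := by linarith
    rw [hg]
    field_simp
    ring
  have hset : {v : E2 | ‖v‖ ^ 2 + (inner ℝ g v) ^ 2 ≤ s ^ 2} = T ⁻¹' Metric.closedBall 0 s := by
    ext v
    simp only [mem_ofPred_eq, mem_preimage, Metric.mem_closedBall, dist_zero_right, ← hT v]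
    exact sq_le_sq₀ (norm_nonneg _) hs
  rw [hset, Measure.addHaar_preimage_linearMap _ (by rw [hdet]; exact hW0.ne'), hdet,
    EuclideanSpace.volume_closedBall_fin_two, abs_of_pos (inv_pos.2 hW0),
    ← ENNReal.ofReal_pow hs, ← ENNReal.ofReal_mul (by positivity),
    ← ENNReal.ofReal_mul (by positivity)]
  congr 1
  ring

/-- Weak form of `∑ ∂ᵢ Xᵢ = 0`, tested against a compactly supported `C¹` function. -/
lemma integral_sum_mul_fderiv_eq_zero {Ω : Set E2} (hopen : IsOpen Ω) {X : Fin 2 → E2 → ℝ}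
    (hX : ∀ i, ContDiffOn ℝ 1 (X i) Ω)
    (hdiv : ∀ x ∈ Ω, ∑ i, fderiv ℝ (X i) x (EuclideanSpace.single i 1) = 0)
    {φ : E2 → ℝ} (hφ : ContDiffOn ℝ 1 φ Ω) (hcomp : HasCompactSupport φ) (hsupp : tsupport φ ⊆ Ω) :
    Integrable (fun x => ∑ i, X i x * fderiv ℝ φ x (EuclideanSpace.single i 1)) ∧
    ∫ x, ∑ i, X i x * fderiv ℝ φ x (EuclideanSpace.single i 1) = 0 := by
  have hsm : ∀ i, ContDiff ℝ 1 (fun x => φ x * X i x) := by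
    intro i
    refine contDiff_iff_contDiffAt.2 fun x => ?_
    by_cases hx : x ∈ Ω
    · exact ((hφ.mul (hX i)) x hx).contDiffAt (hopen.mem_nhds hx)
    · have h1 : φ =ᶠ[𝓝 x] 0 := notMem_tsupport_iff_eventuallyEq.1 fun h => hx (hsupp h)
      have h2 : (fun x => φ x * X i x) =ᶠ[𝓝 x] fun _ => 0 := by
        filter_upwards [h1] with y hy
        simp [hy]
      exact contDiffAt_const.congr_of_eventuallyEq h2
  have hcs : ∀ i, HasCompactSupport (fun x => φ x * X i x) := fun i => hcomp.mul_right
  have hint : ∀ i, Integrable (fun x =>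
      fderiv ℝ (fun x => φ x * X i x) x (EuclideanSpace.single i 1)) := fun i =>
    (((hsm i).continuous_fderiv one_ne_zero).clm_apply
      continuous_const).integrable_of_hasCompactSupport ((hcs i).fderiv_apply ℝ _)
  have hzero : ∀ i, ∫ x, fderiv ℝ (fun x => φ x * X i x) x (EuclideanSpace.single i 1) = 0 := by
    intro i
    have h := integral_mul_fderiv_eq_neg_fderiv_mul_of_integrable (μ := (volume : Measure E2))
      (f := fun x => φ x * X i x) (g := fun _ => (1 : ℝ)) (v := EuclideanSpace.single i 1)
      (by simpa using hint i) (by simp)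
      (by simpa using (hsm i).continuous.integrable_of_hasCompactSupport (hcs i))
      (fun x _ => (hsm i).differentiable one_ne_zero x) (fun x _ => differentiableAt_const _)
    simpa using h
  have heq : (fun x => ∑ i, X i x * fderiv ℝ φ x (EuclideanSpace.single i 1)) =
      fun x => ∑ i, fderiv ℝ (fun x => φ x * X i x) x (EuclideanSpace.single i 1) := by
    funext x
    by_cases hx : x ∈ Ω
    · have hd : ∀ i, fderiv ℝ (fun x => φ x * X i x) x (EuclideanSpace.single i 1) =
          φ x * fderiv ℝ (X i) x (EuclideanSpace.single i 1) +
            X i x * fderiv ℝ φ x (EuclideanSpace.single i 1) := by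
        intro i
        have h1 : DifferentiableAt ℝ φ x :=
          (hφ.differentiableOn one_ne_zero x hx).differentiableAt (hopen.mem_nhds hx)
        have h2 : DifferentiableAt ℝ (X i) x :=
          ((hX i).differentiableOn one_ne_zero x hx).differentiableAt (hopen.mem_nhds hx)
        rw [fderiv_fun_mul h1 h2]
        simp
      simp_rw [hd, Finset.sum_add_distrib, ← Finset.mul_sum, hdiv x hx]
      simp
    · have h1 : φ =ᶠ[𝓝 x] 0 := notMem_tsupport_iff_eventuallyEq.1 fun h => hx (hsupp h)
      have h2 : ∀ i, fderiv ℝ (fun x => φ x * X i x) x = 0 := fun i => by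
        have h3 : (fun x => φ x * X i x) =ᶠ[𝓝 x] fun _ => 0 := by
          filter_upwards [h1] with y hy
          simp [hy]
        rw [h3.fderiv_eq, fderiv_fun_const, Pi.zero_apply]
      simp [h1.fderiv_eq, h2]
  rw [heq]
  refine ⟨integrable_finsetSum _ fun i _ => hint i, ?_⟩
  rw [integral_finsetSum _ fun i _ => hint i]
  simp [hzero]

lemma fderiv_apply_eq_inner_gradient {u : E2 → ℝ} {x : E2} (h : DifferentiableAt ℝ u x) (v : E2) :
    fderiv ℝ u x v = inner ℝ (gradient u x) v :=
  h.hasGradientAt.fderiv_apply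

lemma contDiffOn_gradient {Ω : Set E2} {u : E2 → ℝ} (hopen : IsOpen Ω)
    (hu : ContDiffOn ℝ 2 u Ω) : ContDiffOn ℝ 1 (gradient u) Ω := by
  rw [contDiffOn_euclidean]
  intro i
  have h1 : ContDiffOn ℝ 1 (fun x => fderiv ℝ u x (EuclideanSpace.single i 1)) Ω :=
    (hu.fderiv_of_isOpen hopen (by norm_num)).clm_apply contDiffOn_const
  refine h1.congr fun x hx => ?_
  rw [fderiv_apply_eq_inner_gradient
    ((hu.differentiableOn two_ne_zero x hx).differentiableAt (hopen.mem_nhds hx))]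
  rw [EuclideanSpace.inner_single_right, one_mul]
  rfl

lemma continuousLinearMap_apply_eq_sum (L : E2 →L[ℝ] ℝ) (v : E2) :
    L v = ∑ i, v i * L (EuclideanSpace.single i 1) := by
  conv_lhs => rw [← (EuclideanSpace.basisFun (Fin 2) ℝ).sum_repr v]
  simp

/-- Testing the minimal surface equation with a `C¹` version of `min (u - δ) k`. -/
lemma lintegral_energy_superlevel_le {Ω : Set E2} {u k : E2 → ℝ} {ρ δ : ℝ} (hopen : IsOpen Ω)
    (hu : ContDiffOn ℝ 2 u Ω) (hmse : ∀ x ∈ Ω, msDiv u x = 0)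
    (hcont : ContinuousOn u (closure Ω)) (hbdry : ∀ x ∈ frontier Ω, u x = 0)
    (hk : ContDiff ℝ 1 k) (hk0 : ∀ x, 0 ≤ k x) (hkρ : ∀ x, ρ ≤ ‖x‖ → k x = 0)
    (hk1 : ∀ x, ‖fderiv ℝ k x‖ ≤ 1) (hδ : 0 < δ) :
    ∫⁻ x in {x | x ∈ Ω ∧ 2 * δ < u x ∧ u x < k x},
        ENNReal.ofReal ((√(1 + ‖gradient u x‖ ^ 2))⁻¹ * ‖gradient u x‖ ^ 2) ≤
      volume ({x | x ∈ Ω ∧ k x ≤ u x} ∩ Metric.ball 0 ρ) := by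
  have hcu : ContinuousOn u Ω := hcont.mono subset_closure
  have hgrad := contDiffOn_gradient hopen hu
  have hX : ∀ i : Fin 2, ContDiffOn ℝ 1
      (fun y => (√(1 + ‖gradient u y‖ ^ 2))⁻¹ * gradient u y i) Ω := by
    intro i
    have h1 : ContDiffOn ℝ 1 (fun y => √(1 + ‖gradient u y‖ ^ 2)) Ω :=
      (contDiffOn_const.add (hgrad.norm_sq ℝ)).sqrt fun x _ => by positivity
    exact (h1.inv fun x _ => by positivity).mul ((contDiffOn_euclidean.1 hgrad) i)
  set ψ : E2 → ℝ := fun x => smoothPos δ (u x - δ) - smoothPos δ (u x - δ - k x) with hψ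
  have hψ1 : ContDiffOn ℝ 1 ψ Ω := by
    have hu1 : ContDiffOn ℝ 1 u Ω := hu.of_le (by norm_num)
    exact ((contDiff_smoothPos hδ).comp_contDiffOn (hu1.sub contDiffOn_const)).sub
      ((contDiff_smoothPos hδ).comp_contDiffOn ((hu1.sub contDiffOn_const).sub hk.contDiffOn))
  set φ : E2 → ℝ := Ω.indicator ψ with hφ
  have hφψ : ∀ x ∈ Ω, φ =ᶠ[𝓝 x] ψ := fun x hx => by
    filter_upwards [hopen.mem_nhds hx] with y hy
    exact indicator_of_mem hy _
  have hφ1 : ContDiffOn ℝ 1 φ Ω := hψ1.congr fun x hx => indicator_of_mem hx _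
  set K : Set E2 := closure Ω ∩ u ⁻¹' (Ici δ) ∩ Metric.closedBall 0 ρ with hK
  have hKclosed : IsClosed K :=
    (hcont.preimage_isClosed_of_isClosed isClosed_closure isClosed_Ici).inter
      Metric.isClosed_closedBall
  have hKcomp : IsCompact K :=
    (isCompact_closedBall (0 : E2) ρ).of_isClosed_subset hKclosed inter_subset_right
  have hKΩ : K ⊆ Ω := by
    rintro x ⟨⟨hx1, hx2⟩, -⟩
    by_contra hx
    have h0 : u x = 0 := hbdry x ⟨hx1, by rwa [hopen.interior_eq]⟩
    rw [mem_preimage, mem_Ici, h0] at hx2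
    linarith
  have hsuppK : Function.support φ ⊆ K := by
    intro x hx
    have hxΩ : x ∈ Ω := by
      by_contra h
      exact hx (indicator_of_notMem h _)
    have hx' : ψ x ≠ 0 := by
      rwa [Function.mem_support, hφ, indicator_of_mem hxΩ] at hx
    refine ⟨⟨subset_closure hxΩ, ?_⟩, ?_⟩
    · by_contra h
      have h' : u x < δ := not_le.1 h
      apply hx'
      simp only [hψ]
      rw [smoothPos_of_nonpos hδ (by linarith), smoothPos_of_nonpos hδ (by linarith [hk0 x]),
        sub_zero]
    · by_contra h
      have h' : ρ < ‖x‖ := by simpa using h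
      apply hx'
      simp only [hψ]
      rw [hkρ x h'.le, sub_zero, sub_self]
  have htsupp : tsupport φ ⊆ K := closure_minimal hsuppK hKclosed
  have hcomp : HasCompactSupport φ := hKcomp.of_isClosed_subset (isClosed_tsupport φ) htsupp
  obtain ⟨hint, hzero⟩ :=
    integral_sum_mul_fderiv_eq_zero hopen hX hmse hφ1 hcomp (htsupp.trans hKΩ)
  set F : E2 → ℝ := fun x => ∑ i : Fin 2, ((√(1 + ‖gradient u x‖ ^ 2))⁻¹ * gradient u x i) *
    fderiv ℝ φ x (EuclideanSpace.single i 1) with hF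
  set e : E2 → ℝ := fun x => (√(1 + ‖gradient u x‖ ^ 2))⁻¹ * ‖gradient u x‖ ^ 2 with he
  set A : Set E2 := {x | x ∈ Ω ∧ 2 * δ < u x ∧ u x < k x} with hA
  set B : Set E2 := {x | x ∈ Ω ∧ k x ≤ u x} ∩ Metric.ball 0 ρ with hB
  have hFΩ : ∀ x ∈ Ω, F x = (smoothPosDeriv δ (u x - δ) - smoothPosDeriv δ (u x - δ - k x)) * e x +
      smoothPosDeriv δ (u x - δ - k x) *
        ((√(1 + ‖gradient u x‖ ^ 2))⁻¹ * fderiv ℝ k x (gradient u x)) := by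
    intro x hx
    have hud : DifferentiableAt ℝ u x :=
      (hu.differentiableOn two_ne_zero x hx).differentiableAt (hopen.mem_nhds hx)
    have hkd := (hk.differentiable one_ne_zero x).hasFDerivAt
    have h1 : HasFDerivAt ψ
        (smoothPosDeriv δ (u x - δ) • fderiv ℝ u x -
          smoothPosDeriv δ (u x - δ - k x) • (fderiv ℝ u x - fderiv ℝ k x)) x :=
      ((hasDerivAt_smoothPos hδ _).comp_hasFDerivAt x (hud.hasFDerivAt.sub_const δ)).sub
        ((hasDerivAt_smoothPos hδ _).comp_hasFDerivAt x ((hud.hasFDerivAt.sub_const δ).sub hkd))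
    have h2 : F x = (√(1 + ‖gradient u x‖ ^ 2))⁻¹ * fderiv ℝ φ x (gradient u x) := by
      rw [continuousLinearMap_apply_eq_sum, Finset.mul_sum]
      simp only [hF, mul_assoc]
    rw [h2, (hφψ x hx).fderiv_eq, h1.fderiv]
    simp only [sub_apply, smul_apply, smul_eq_mul,
      fderiv_apply_eq_inner_gradient hud, real_inner_self_eq_norm_sq, he]
    ring
  have hFout : ∀ x, x ∉ Ω → F x = 0 := by
    intro x hx
    have h1 : φ =ᶠ[𝓝 x] 0 := notMem_tsupport_iff_eventuallyEq.1 fun h => hx (hKΩ (htsupp h))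
    simp [hF, h1.fderiv_eq]
  have he0 : ∀ x, 0 ≤ e x := fun x => by simp only [he]; positivity
  have hle : ∀ x, A.indicator e x ≤ F x + B.indicator (fun _ => (1 : ℝ)) x := by
    intro x
    have hB0 : 0 ≤ B.indicator (fun _ => (1 : ℝ)) x := indicator_nonneg (fun _ _ => zero_le_one) x
    by_cases hx : x ∈ Ω
    swap
    · rw [hFout x hx, indicator_of_notMem fun h => hx h.1]
      linarith
    have hmono : smoothPosDeriv δ (u x - δ - k x) ≤ smoothPosDeriv δ (u x - δ) :=
      monotone_smoothPosDeriv hδ (by linarith [hk0 x])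
    rw [hFΩ x hx]
    by_cases hxk : u x < k x
    · rw [smoothPosDeriv_of_nonpos hδ (show u x - δ - k x ≤ 0 by linarith)]
      by_cases hxA : x ∈ A
      · rw [indicator_of_mem hxA, smoothPosDeriv_of_ge hδ (by linarith [hxA.2.1])]
        linarith
      · rw [indicator_of_notMem hxA]
        have := mul_nonneg (smoothPosDeriv_nonneg hδ (u x - δ)) (he0 x)
        linarith
    · rw [not_lt] at hxk
      rw [indicator_of_notMem fun h => absurd h.2.2 (not_lt.2 hxk)]
      have h1 := mul_nonneg (sub_nonneg.2 hmono) (he0 x)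
      by_cases hxρ : ‖x‖ < ρ
      · rw [indicator_of_mem (show x ∈ B from ⟨⟨hx, hxk⟩, by simpa using hxρ⟩)]
        have hW : 0 < √(1 + ‖gradient u x‖ ^ 2) := Real.sqrt_pos.2 (by positivity)
        have h2 : |(√(1 + ‖gradient u x‖ ^ 2))⁻¹ * fderiv ℝ k x (gradient u x)| ≤ 1 := by
          rw [abs_mul, abs_of_pos (inv_pos.2 hW), inv_mul_le_iff₀ hW, mul_one]
          calc |fderiv ℝ k x (gradient u x)| ≤ ‖fderiv ℝ k x‖ * ‖gradient u x‖ :=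
                (fderiv ℝ k x).le_opNorm _
            _ ≤ 1 * ‖gradient u x‖ := by gcongr; exact hk1 x
            _ ≤ √(1 + ‖gradient u x‖ ^ 2) := by
                rw [one_mul]
                exact Real.le_sqrt_of_sq_le (by linarith)
        have h3 := smoothPosDeriv_nonneg hδ (u x - δ - k x)
        have h4 := smoothPosDeriv_le_one hδ (u x - δ - k x)
        nlinarith [neg_le_of_abs_le h2]
      · have hkx : k x = 0 := hkρ x (not_lt.1 hxρ)
        have hmin : IsLocalMin k x := Eventually.of_forall fun y => by rw [hkx]; exact hk0 y
        rw [hmin.fderiv_eq_zero]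
        simp only [zero_apply, mul_zero]
        linarith
  have hAmeas : MeasurableSet A := by
    have h1 : IsOpen (Ω ∩ u ⁻¹' Ioi (2 * δ)) := hcu.isOpen_inter_preimage hopen isOpen_Ioi
    have h2 : IsOpen (Ω ∩ (fun x => u x - k x) ⁻¹' Iio 0) :=
      (hcu.sub hk.continuous.continuousOn).isOpen_inter_preimage hopen isOpen_Iio
    convert (h1.inter h2).measurableSet using 1
    ext x
    simp only [hA, mem_ofPred_eq, mem_inter_iff, mem_preimage, mem_Ioi, mem_Iio, sub_neg]
    tauto
  have hBmeas : MeasurableSet B := by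
    have h2 : IsOpen (Ω ∩ (fun x => u x - k x) ⁻¹' Iio 0) :=
      (hcu.sub hk.continuous.continuousOn).isOpen_inter_preimage hopen isOpen_Iio
    refine MeasurableSet.inter ?_ measurableSet_ball
    convert hopen.measurableSet.diff h2.measurableSet using 1
    ext x
    simp only [mem_ofPred_eq, mem_inter_iff, mem_preimage, mem_Iio, sub_neg, Set.mem_sdiff, not_and,
      not_lt]
    tauto
  have hBfin : volume B ≠ ∞ :=
    ((measure_mono inter_subset_right).trans_lt measure_ball_lt_top).ne
  have hBint : Integrable (B.indicator fun _ => (1 : ℝ)) :=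
    (integrable_indicator_iff hBmeas).2 (integrableOn_const hBfin)
  calc ∫⁻ x in A, ENNReal.ofReal (e x)
      = ∫⁻ x, A.indicator (fun x => ENNReal.ofReal (e x)) x := (lintegral_indicator hAmeas _).symm
    _ ≤ ∫⁻ x, ENNReal.ofReal (F x + B.indicator (fun _ => (1 : ℝ)) x) := by
        refine lintegral_mono fun x => ?_
        refine le_trans (le_of_eq ?_) (ENNReal.ofReal_le_ofReal (hle x))
        by_cases hx : x ∈ A <;> simp [hx]
    _ = ENNReal.ofReal (∫ x, (F x + B.indicator (fun _ => (1 : ℝ)) x)) := by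
        refine (ofReal_integral_eq_lintegral_ofReal (hint.add hBint) ?_).symm
        exact Eventually.of_forall fun x => (indicator_nonneg (fun y _ => he0 y) x).trans (hle x)
    _ = volume B := by
        rw [integral_add hint hBint, hzero, zero_add, integral_indicator_const _ hBmeas, smul_eq_mul,
          mul_one, ofReal_measureReal hBfin]

/-- The graph of `u` over `{u < k}` has area at most that of the disc supporting `k`. -/
lemma lintegral_area_sublevel_le {Ω : Set E2} {u k : E2 → ℝ} {ρ : ℝ} (hopen : IsOpen Ω)
    (hu : ContDiffOn ℝ 2 u Ω) (hmse : ∀ x ∈ Ω, msDiv u x = 0) (hnonneg : ∀ x ∈ Ω, 0 ≤ u x)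
    (hcont : ContinuousOn u (closure Ω)) (hbdry : ∀ x ∈ frontier Ω, u x = 0)
    (hk : ContDiff ℝ 1 k) (hk0 : ∀ x, 0 ≤ k x) (hkρ : ∀ x, ρ ≤ ‖x‖ → k x = 0)
    (hk1 : ∀ x, ‖fderiv ℝ k x‖ ≤ 1) :
    ∫⁻ x in {x | x ∈ Ω ∧ u x < k x}, ENNReal.ofReal (√(1 + ‖gradient u x‖ ^ 2)) ≤
      volume (Metric.ball (0 : E2) ρ) := by
  have hcu : ContinuousOn u Ω := hcont.mono subset_closure
  set e : E2 → ℝ := fun x => (√(1 + ‖gradient u x‖ ^ 2))⁻¹ * ‖gradient u x‖ ^ 2 with he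
  set U : Set E2 := {x | x ∈ Ω ∧ u x < k x} with hU
  set A : ℕ → Set E2 := fun n => {x | x ∈ Ω ∧ 2 * (1 / (n + 1 : ℝ)) < u x ∧ u x < k x} with hA
  set Z : Set E2 := {x | x ∈ Ω ∧ u x = 0} with hZ
  set B : Set E2 := {x | x ∈ Ω ∧ k x ≤ u x} ∩ Metric.ball 0 ρ with hB
  have hUopen : IsOpen U := by
    convert (hcu.sub hk.continuous.continuousOn).isOpen_inter_preimage hopen
      (isOpen_Iio (a := (0 : ℝ))) using 1
    ext x
    simp [hU]
  have hZmeas : MeasurableSet Z := by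
    convert hopen.measurableSet.diff
      (hcu.isOpen_inter_preimage hopen (isOpen_Ioi (a := (0 : ℝ)))).measurableSet using 1
    ext x
    simp only [hZ, mem_ofPred_eq, Set.mem_sdiff, mem_inter_iff, mem_preimage, mem_Ioi, not_and,
      not_lt]
    exact ⟨fun h => ⟨h.1, fun _ => h.2.le⟩, fun h => ⟨h.1, le_antisymm (h.2 h.1) (hnonneg x h.1)⟩⟩
  have hcover : U ⊆ (⋃ n, A n) ∪ Z := by
    rintro x ⟨hx, hxk⟩
    rcases (hnonneg x hx).eq_or_lt with h | h
    · exact Or.inr ⟨hx, h.symm⟩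
    · obtain ⟨n, hn⟩ := exists_nat_one_div_lt (half_pos h)
      exact Or.inl (mem_iUnion.2 ⟨n, hx, by linarith, hxk⟩)
  have hdir : Directed (· ⊆ ·) A := by
    refine directed_of_isDirected_le fun m n hmn x hx => ⟨hx.1, lt_of_le_of_lt ?_ hx.2.1, hx.2.2⟩
    have := Nat.one_div_le_one_div (α := ℝ) hmn
    linarith
  have hZ0 : ∫⁻ x in Z, ENNReal.ofReal (e x) = 0 := by
    rw [setLIntegral_congr_fun (g := fun _ => 0) hZmeas, lintegral_zero]
    rintro x ⟨hx, hx0⟩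
    have hmin : IsLocalMin u x := by
      filter_upwards [hopen.mem_nhds hx] with y hy
      rw [hx0]
      exact hnonneg y hy
    have : gradient u x = 0 := by simp [gradient, hmin.fderiv_eq_zero]
    simp [he, this]
  have henergy : ∫⁻ x in U, ENNReal.ofReal (e x) ≤ volume B := by
    calc ∫⁻ x in U, ENNReal.ofReal (e x)
        ≤ ∫⁻ x in (⋃ n, A n) ∪ Z, ENNReal.ofReal (e x) := lintegral_mono_set hcover
      _ ≤ (∫⁻ x in ⋃ n, A n, ENNReal.ofReal (e x)) + ∫⁻ x in Z, ENNReal.ofReal (e x) :=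
          lintegral_union_le _ _ _
      _ = ⨆ n, ∫⁻ x in A n, ENNReal.ofReal (e x) := by
          rw [hZ0, add_zero, setLIntegral_iUnion_of_directed _ hdir]
      _ ≤ volume B := iSup_le fun n => lintegral_energy_superlevel_le hopen hu hmse hcont hbdry
          hk hk0 hkρ hk1 (by positivity)
  have hUball : U ⊆ Metric.ball 0 ρ := by
    rintro x ⟨hx, hxk⟩
    by_contra h
    have := hkρ x (by simpa using h)
    linarith [hnonneg x hx]
  calc ∫⁻ x in U, ENNReal.ofReal (√(1 + ‖gradient u x‖ ^ 2))
      ≤ ∫⁻ x in U, (1 + ENNReal.ofReal (e x)) := by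
        refine lintegral_mono fun x => ?_
        rw [← ENNReal.ofReal_one, ← ENNReal.ofReal_add zero_le_one (by simp only [he]; positivity)]
        refine ENNReal.ofReal_le_ofReal ?_
        have h1 : 1 ≤ √(1 + ‖gradient u x‖ ^ 2) :=
          Real.one_le_sqrt.2 (by nlinarith [sq_nonneg ‖gradient u x‖])
        have h2 : √(1 + ‖gradient u x‖ ^ 2) ^ 2 = 1 + ‖gradient u x‖ ^ 2 :=
          Real.sq_sqrt (by positivity)
        have h3 : ‖gradient u x‖ ^ 2 = √(1 + ‖gradient u x‖ ^ 2) ^ 2 - 1 := by linarith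
        simp only [he]
        rw [inv_mul_eq_div]
        have h4 : √(1 + ‖gradient u x‖ ^ 2) - 1 ≤
            ‖gradient u x‖ ^ 2 / √(1 + ‖gradient u x‖ ^ 2) := by
          rw [le_div_iff₀ (by linarith)]
          nlinarith
        linarith
    _ = volume U + ∫⁻ x in U, ENNReal.ofReal (e x) := by
        rw [lintegral_add_left measurable_const, setLIntegral_one]
    _ ≤ volume U + volume B := by gcongr
    _ = volume (U ∪ B) := by
        rw [measure_union' _ hUopen.measurableSet]
        rw [Set.disjoint_left]
        rintro x ⟨-, h1⟩ ⟨⟨-, h2⟩, -⟩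
        exact absurd h1 (not_lt.2 h2)
    _ ≤ volume (Metric.ball (0 : E2) ρ) := measure_mono (union_subset hUball inter_subset_right)

lemma norm_toE3_sq (x : E2) (t : ℝ) : ‖toE3 x t‖ ^ 2 = ‖x‖ ^ 2 + t ^ 2 := by
  simp [toE3, EuclideanSpace.norm_sq_eq, Fin.sum_univ_succ, add_assoc]

lemma dist_toE3_sq (x y : E2) (s t : ℝ) :
    dist (toE3 x s) (toE3 y t) ^ 2 = ‖x - y‖ ^ 2 + (s - t) ^ 2 := by
  have : toE3 x s - toE3 y t = toE3 (x - y) (s - t) := by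
    ext i
    fin_cases i <;> simp [toE3]
  rw [dist_eq_norm, this, norm_toE3_sq]

lemma continuous_toE3 : Continuous fun p : E2 × ℝ => toE3 p.1 p.2 := by
  unfold toE3
  refine (EuclideanSpace.equiv (Fin 3) ℝ).symm.continuous.comp (continuous_pi fun i => ?_)
  fin_cases i <;> simp <;> fun_prop

/-- The area measure of a graph, on small balls centred on it, is at least nearly `π r²`. -/
lemma eventually_le_lintegral_area_closedBall {U : Set E2} {u : E2 → ℝ} (hU : IsOpen U)
    (hu : ContDiffOn ℝ 2 u U) {ε : ℝ} (hε : 0 < ε) {x : E2} (hx : x ∈ U) :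
    ∃ r₀ > 0, ∀ r, 0 < r → r < r₀ →
      ENNReal.ofReal (π * r ^ 2 / (1 + ε) ^ 3) ≤
        ∫⁻ y in {y | y ∈ U ∧ toE3 y (u y) ∈ Metric.closedBall (toE3 x (u x)) r},
          ENNReal.ofReal (√(1 + ‖gradient u y‖ ^ 2)) := by
  set g := gradient u x with hg
  set W := √(1 + ‖g‖ ^ 2) with hW
  have hW0 : 0 < W := Real.sqrt_pos.2 (by positivity)
  have hxU := hU.mem_nhds hx
  have hud : DifferentiableAt ℝ u x := (hu.differentiableOn two_ne_zero x hx).differentiableAt hxU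
  have hlin : ∀ᶠ y in 𝓝 x, |u y - u x - inner ℝ g (y - x)| ≤ ε * ‖y - x‖ := by
    have h := (hasFDerivAt_iff_isLittleO.1 hud.hasFDerivAt).def hε
    filter_upwards [h] with y hy
    rwa [fderiv_apply_eq_inner_gradient hud, Real.norm_eq_abs] at hy
  have hcont : ∀ᶠ y in 𝓝 x, W / (1 + ε) < √(1 + ‖gradient u y‖ ^ 2) := by
    have h1 : ContinuousAt (fun y => √(1 + ‖gradient u y‖ ^ 2)) x :=
      (continuousAt_const.add
        (((contDiffOn_gradient hU hu).continuousOn.continuousAt hxU).norm.pow 2)).sqrt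
    exact h1.eventually (lt_mem_nhds (div_lt_self hW0 (by linarith)))
  obtain ⟨r₀, hr₀, hball⟩ := Metric.eventually_nhds_iff.1 (hlin.and (hcont.and hxU))
  refine ⟨r₀, hr₀, fun r hr hrr₀ => ?_⟩
  set s := r / (1 + ε) with hs
  have hs0 : 0 ≤ s := by positivity
  have hsr : s ≤ r := div_le_self hr.le (by linarith)
  set E : Set E2 := (fun y => y - x) ⁻¹' {v : E2 | ‖v‖ ^ 2 + (inner ℝ g v) ^ 2 ≤ s ^ 2} with hE
  have hEr : ∀ y ∈ E, dist y x < r₀ := by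
    intro y hy
    have h1 : ‖y - x‖ ^ 2 ≤ s ^ 2 := by
      have : ‖y - x‖ ^ 2 + (inner ℝ g (y - x)) ^ 2 ≤ s ^ 2 := hy
      linarith [sq_nonneg (inner ℝ g (y - x))]
    rw [dist_eq_norm]
    exact ((pow_le_pow_iff_left₀ (norm_nonneg _) hs0 two_ne_zero).1 h1).trans_lt
      (hsr.trans_lt hrr₀)
  have hEsub : E ⊆ {y | y ∈ U ∧ toE3 y (u y) ∈ Metric.closedBall (toE3 x (u x)) r} := by
    intro y hy
    obtain ⟨h1, -, h3⟩ := hball (hEr y hy)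
    refine ⟨h3, ?_⟩
    rw [Metric.mem_closedBall, ← pow_le_pow_iff_left₀ dist_nonneg hr.le two_ne_zero, dist_toE3_sq]
    have hy' : ‖y - x‖ ^ 2 + (inner ℝ g (y - x)) ^ 2 ≤ s ^ 2 := hy
    have hrs : r ^ 2 = (1 + ε) ^ 2 * s ^ 2 := by rw [hs]; field_simp
    set a := ‖y - x‖ with ha
    have ha0 : 0 ≤ a := norm_nonneg _
    set b := inner ℝ g (y - x) with hb
    have h4 : |u y - u x| ≤ |b| + ε * a := by
      have : u y - u x = b + (u y - u x - b) := by ring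
      rw [this]
      exact (abs_add_le _ _).trans (by linarith)
    have h5 : (u y - u x) ^ 2 ≤ (|b| + ε * a) ^ 2 := by
      rw [← sq_abs]
      exact pow_le_pow_left₀ (abs_nonneg _) h4 2
    have h6 : 2 * (|b| * a) ≤ b ^ 2 + a ^ 2 := by
      nlinarith [sq_nonneg (|b| - a), sq_abs b]
    have h7 : (|b| + ε * a) ^ 2 = b ^ 2 + ε * (2 * (|b| * a)) + ε ^ 2 * a ^ 2 := by
      rw [← sq_abs b]; ring
    have h8 : ε * (2 * (|b| * a)) ≤ ε * (b ^ 2 + a ^ 2) := by gcongr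
    rw [hrs]
    have h9 : (1 + ε) ^ 2 * (a ^ 2 + b ^ 2) ≤ (1 + ε) ^ 2 * s ^ 2 := by gcongr
    have h10 : 0 ≤ ε * (a ^ 2 + b ^ 2) + ε ^ 2 * b ^ 2 := by positivity
    nlinarith
  have hEmeas : MeasurableSet E := by
    refine (IsClosed.measurableSet ?_)
    exact (isClosed_le (by fun_prop) continuous_const).preimage (by fun_prop)
  have hEvol : volume E = ENNReal.ofReal (π * s ^ 2 * W⁻¹) := by
    simp only [hE, sub_eq_add_neg]
    rw [measure_preimage_add_right, volume_ellipse g hs0]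
  calc ENNReal.ofReal (π * r ^ 2 / (1 + ε) ^ 3)
      = ENNReal.ofReal (W / (1 + ε)) * volume E := by
        rw [hEvol, ← ENNReal.ofReal_mul (by positivity)]
        congr 1
        rw [hs]
        field_simp
    _ = ∫⁻ _ in E, ENNReal.ofReal (W / (1 + ε)) := (setLIntegral_const _ _).symm
    _ ≤ ∫⁻ y in E, ENNReal.ofReal (√(1 + ‖gradient u y‖ ^ 2)) :=
        setLIntegral_mono' hEmeas fun y hy => ENNReal.ofReal_le_ofReal (hball (hEr y hy)).2.1.le
    _ ≤ _ := lintegral_mono_set hEsub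

/-- Mathlib's Hausdorff measure is `4 / π` times the normalised one, hence the constant. -/
lemma hausdorffMeasure_graph_le {U : Set E2} {u : E2 → ℝ} (hU : IsOpen U)
    (hu : ContDiffOn ℝ 2 u U)
    (hfin : ∫⁻ y in U, ENNReal.ofReal (√(1 + ‖gradient u y‖ ^ 2)) ≠ ∞) {ε : ℝ} (hε : 0 < ε) :
    μH[2] ((fun x => toE3 x (u x)) '' U) ≤ ENNReal.ofReal (4 / π * (1 + ε) ^ 3) *
      ∫⁻ y in U, ENNReal.ofReal (√(1 + ‖gradient u y‖ ^ 2)) := by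
  set w : E2 → ℝ≥0∞ := fun y => ENNReal.ofReal (√(1 + ‖gradient u y‖ ^ 2)) with hw
  set Φ : E2 → E3 := fun x => toE3 x (u x) with hΦ
  set C := ENNReal.ofReal (4 / π * (1 + ε) ^ 3) with hC
  have hΦc : ContinuousOn Φ U :=
    continuous_toE3.comp_continuousOn (continuousOn_id.prodMk hu.continuousOn)
  set ν : Measure E2 := (volume.restrict U).withDensity w with hν
  have hΦm : AEMeasurable Φ ν :=
    (hΦc.aemeasurable hU.measurableSet).mono_ac (withDensity_absolutelyContinuous _ _)
  set m : Measure E3 := ν.map Φ with hm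
  have hνuniv : ν univ = ∫⁻ y in U, w y := by
    rw [hν, withDensity_apply _ MeasurableSet.univ, Measure.restrict_univ]
  have hmle : ∀ s, m s ≤ ∫⁻ y in U, w y := fun s =>
    (measure_mono (subset_univ s)).trans
      (by rw [hm, Measure.map_apply_of_aemeasurable hΦm MeasurableSet.univ, preimage_univ, hνuniv])
  have : IsFiniteMeasure m := ⟨(hmle univ).trans_lt hfin.lt_top⟩
  have hdens : ∀ x ∈ U, ∃ r₀ > 0, ∀ r, 0 < r → r < r₀ →
      ENNReal.ofReal (2 * r) ^ 2 ≤ C * m (Metric.closedBall (Φ x) r) := by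
    intro x hx
    obtain ⟨r₀, hr₀, h⟩ := eventually_le_lintegral_area_closedBall hU hu hε hx
    refine ⟨r₀, hr₀, fun r hr hrr₀ => ?_⟩
    have hball : m (Metric.closedBall (Φ x) r) =
        ∫⁻ y in {y | y ∈ U ∧ Φ y ∈ Metric.closedBall (Φ x) r}, w y := by
      rw [hm, Measure.map_apply_of_aemeasurable hΦm Metric.isClosed_closedBall.measurableSet, hν,
        withDensity_apply', Measure.restrict_restrict' hU.measurableSet, inter_comm]
      rfl
    calc ENNReal.ofReal (2 * r) ^ 2
        = C * ENNReal.ofReal (π * r ^ 2 / (1 + ε) ^ 3) := by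
          rw [hC, ← ENNReal.ofReal_mul (by positivity), ← ENNReal.ofReal_pow (by positivity)]
          congr 1
          field_simp
          norm_num
      _ ≤ C * m (Metric.closedBall (Φ x) r) := by rw [hball]; gcongr; exact h r hr hrr₀
  have hcover : ∀ n : ℕ, ∃ (t : Set E3) (r : E3 → ℝ), t.Countable ∧
      (∀ p ∈ t, 0 < r p ∧ r p < 1 / (n + 1 : ℝ) ∧
        ENNReal.ofReal (2 * r p) ^ 2 ≤ C * m (Metric.closedBall p (r p))) ∧
      Φ '' U ⊆ ⋃ p ∈ t, Metric.closedBall p (r p) ∧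
      ∑' p : t, m (Metric.closedBall p (r p)) ≤ (∫⁻ y in U, w y) + ENNReal.ofReal (1 / (n + 1)) := by
    intro n
    have hn : (0 : ℝ) < 1 / (n + 1) := Nat.one_div_pos_of_nat
    obtain ⟨t, r, ht, -, hr, hsub, hsum⟩ := Besicovitch.exists_closedBall_covering_tsum_measure_le m
      (ENNReal.ofReal_pos.2 hn).ne'
      (fun p => {r | 0 < r ∧ r < 1 / (n + 1 : ℝ) ∧
        ENNReal.ofReal (2 * r) ^ 2 ≤ C * m (Metric.closedBall p r)}) (Φ '' U) (by
          rintro _ ⟨x, hx, rfl⟩ δ hδ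
          obtain ⟨r₀, hr₀, h⟩ := hdens x hx
          obtain ⟨r, hr, hr'⟩ := exists_between (lt_min hδ (lt_min hr₀ hn))
          rw [lt_min_iff, lt_min_iff] at hr'
          exact ⟨r, ⟨hr, hr'.2.2, h r hr hr'.2.1⟩, hr, hr'.1⟩)
    exact ⟨t, r, ht, hr, hsub, hsum.trans (by gcongr; exact hmle _)⟩
  choose t r ht hr hsub hsum using hcover
  have : ∀ n, Countable (t n) := fun n => (ht n).to_subtype
  have hdiam : ∀ n (p : t n), Metric.ediam (Metric.closedBall (p : E3) (r n p)) ≤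
      ENNReal.ofReal (2 * r n p) := fun n p => by
    refine Metric.ediam_le fun a ha b hb => ?_
    rw [edist_dist]
    refine ENNReal.ofReal_le_ofReal ?_
    linarith [dist_triangle_right a b p, Metric.mem_closedBall.1 ha, Metric.mem_closedBall.1 hb]
  have hlim : Tendsto (fun n : ℕ => ENNReal.ofReal (1 / (n + 1 : ℝ))) atTop (𝓝 0) := by
    simpa using ENNReal.tendsto_ofReal tendsto_one_div_add_atTop_nhds_zero_nat
  have hlim2 : Tendsto (fun n : ℕ => ENNReal.ofReal (2 * (1 / (n + 1 : ℝ)))) atTop (𝓝 0) := by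
    simpa using ENNReal.tendsto_ofReal
      ((tendsto_one_div_add_atTop_nhds_zero_nat (𝕜 := ℝ)).const_mul 2)
  refine (Measure.hausdorffMeasure_le_liminf_tsum 2 (Φ '' U) _ hlim2
    (fun n (p : t n) => Metric.closedBall (p : E3) (r n p))
    (Eventually.of_forall fun n p => (hdiam n p).trans (ENNReal.ofReal_le_ofReal
      (mul_le_mul_of_nonneg_left (hr n p p.2).2.1.le zero_le_two)))
    (Eventually.of_forall fun n => by simpa only [iUnion_coe_set] using hsub n)).trans ?_
  have hbound : ∀ n, ∑' p : t n, Metric.ediam (Metric.closedBall (p : E3) (r n p)) ^ (2 : ℝ) ≤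
      C * ((∫⁻ y in U, w y) + ENNReal.ofReal (1 / (n + 1))) := fun n =>
    calc ∑' p : t n, Metric.ediam (Metric.closedBall (p : E3) (r n p)) ^ (2 : ℝ)
        ≤ ∑' p : t n, C * m (Metric.closedBall (p : E3) (r n p)) := by
          refine ENNReal.tsum_le_tsum fun p => ?_
          rw [ENNReal.rpow_two]
          exact (pow_le_pow_left₀ zero_le (hdiam n p) 2).trans (hr n p p.2).2.2
      _ ≤ _ := by
          rw [ENNReal.tsum_mul_left]
          gcongr
          exact hsum n
  have hlim3 : Tendsto (fun n : ℕ => C * ((∫⁻ y in U, w y) + ENNReal.ofReal (1 / (n + 1 : ℝ))))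
      atTop (𝓝 (C * ((∫⁻ y in U, w y) + 0))) :=
    ENNReal.Tendsto.const_mul (hlim.const_add _) (Or.inr ENNReal.ofReal_ne_top)
  rw [add_zero] at hlim3
  rw [← hlim3.liminf_eq]
  exact liminf_le_liminf (Eventually.of_forall hbound)

/-- A `C¹` function with gradient at most `1`, supported in the disc of radius `3R/2`, whose graph
lies above the hemisphere of radius `R`. -/
lemma exists_barrier {R : ℝ} (hR : 0 < R) : ∃ k : E2 → ℝ, ContDiff ℝ 1 k ∧ (∀ x, 0 ≤ k x) ∧
    (∀ x, 3 / 2 * R ≤ ‖x‖ → k x = 0) ∧ (∀ x, ‖fderiv ℝ k x‖ ≤ 1) ∧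
    ∀ x t, ‖x‖ ^ 2 + t ^ 2 ≤ R ^ 2 → t < k x := by
  have hδ : 0 < R / 40 := by positivity
  set q : E2 → ℝ := fun x => √(R ^ 2 / 16 + ‖x‖ ^ 2) with hq
  have hq0 : ∀ x, 0 < q x := fun x => Real.sqrt_pos.2 (by positivity)
  have hqsq : ∀ x, q x ^ 2 = R ^ 2 / 16 + ‖x‖ ^ 2 := fun x => Real.sq_sqrt (by positivity)
  have hqx : ∀ x, ‖x‖ ≤ q x := fun x => Real.le_sqrt_of_sq_le (by nlinarith)
  have hq1 : ContDiff ℝ 1 q :=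
    (contDiff_const.add (contDiff_norm_sq ℝ)).sqrt fun x => by positivity
  refine ⟨fun x => smoothPos (R / 40) (3 / 2 * R - q x),
    (contDiff_smoothPos hδ).comp (contDiff_const.sub hq1), fun x => smoothPos_nonneg hδ _,
    fun x hx => smoothPos_of_nonpos hδ (by linarith [hqx x]), fun x => ?_, fun x t hxt => ?_⟩
  · have hfd : HasFDerivAt q ((1 / (2 * q x)) • (2 • (innerSL ℝ x))) x := by
      have h1 : HasFDerivAt (fun y : E2 => R ^ 2 / 16 + ‖y‖ ^ 2) (2 • (innerSL ℝ x)) x :=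
        (hasStrictFDerivAt_norm_sq x).hasFDerivAt.const_add _
      exact h1.sqrt (by positivity)
    have h2 := (hasDerivAt_smoothPos hδ (3 / 2 * R - q x)).comp_hasFDerivAt x
      (hfd.const_sub (3 / 2 * R))
    have h3 : ‖(1 / (2 * q x)) • (2 • (innerSL ℝ x))‖ ≤ 1 := by
      rw [norm_smul, ← Nat.cast_smul_eq_nsmul ℝ, norm_smul, innerSL_apply_norm, Real.norm_eq_abs,
        abs_of_pos (one_div_pos.2 (mul_pos two_pos (hq0 x)))]
      have := hqx x
      have := hq0 x
      rw [one_div, inv_mul_le_iff₀ (by positivity)]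
      simpa using by linarith
    have h4 : fderiv ℝ (fun x => smoothPos (R / 40) (3 / 2 * R - q x)) x = _ := h2.fderiv
    rw [h4, norm_smul, norm_neg, Real.norm_of_nonneg (smoothPosDeriv_nonneg hδ _)]
    exact mul_le_one₀ (smoothPosDeriv_le_one hδ _) (norm_nonneg _) h3
  · refine lt_of_lt_of_le ?_ (sub_le_smoothPos hδ _)
    nlinarith [hqsq x, hq0 x, sq_nonneg (t - q x), sq_nonneg (t + q x)]

/-- **Area growth estimate for a supported minimal graph.** If `(Ω,u)` is a minimal graph
in `ℝ³` supported on the open set `Ω ⊆ ℝ²`, then for every `R > 0` the area of the part of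
the graph `G = {(x,u(x)) : x ∈ Ω}` inside the closed ball `B³(R)` of radius `R` centered at
the origin satisfies `A(G ∩ B³(R)) ≤ 3πR²`. -/
theorem minimal_graph_area_growth
    (Ω : Set E2) (u : E2 → ℝ)
    (hopen : IsOpen Ω)
    (hsmooth : ContDiffOn ℝ (⊤ : ℕ∞) u Ω)
    (hmse : ∀ x ∈ Ω, msDiv u x = 0)
    (hnonneg : ∀ x ∈ Ω, 0 ≤ u x)
    (hcont : ContinuousOn u (closure Ω))
    (hbdry : ∀ x ∈ frontier Ω, u x = 0) :
    ∀ R > (0 : ℝ),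
      μH[2] (((fun x => toE3 x (u x)) '' Ω) ∩ Metric.closedBall (0 : E3) R) ≤
        ENNReal.ofReal (3 * π * R ^ 2) := by
  intro R hR
  have hu : ContDiffOn ℝ 2 u Ω := hsmooth.of_le (WithTop.coe_le_coe.2 le_top)
  obtain ⟨k, hk, hk0, hkρ, hk1, hkR⟩ := exists_barrier hR
  set U : Set E2 := {x | x ∈ Ω ∧ u x < k x} with hU
  have hUopen : IsOpen U := by
    convert ((hcont.mono subset_closure).sub hk.continuous.continuousOn).isOpen_inter_preimage hopen
      (isOpen_Iio (a := (0 : ℝ))) using 1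
    ext x
    simp [hU]
  have harea : ∫⁻ x in U, ENNReal.ofReal (√(1 + ‖gradient u x‖ ^ 2)) ≤
      ENNReal.ofReal (9 / 4 * π * R ^ 2) := by
    refine (lintegral_area_sublevel_le hopen hu hmse hnonneg hcont hbdry hk hk0 hkρ hk1).trans_eq ?_
    rw [EuclideanSpace.volume_ball_fin_two, ← ENNReal.ofReal_pow (by positivity),
      ← ENNReal.ofReal_mul (by positivity)]
    congr 1
    ring
  have hsub : ((fun x => toE3 x (u x)) '' Ω) ∩ Metric.closedBall (0 : E3) R ⊆
      (fun x => toE3 x (u x)) '' U := by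
    rintro _ ⟨⟨x, hx, rfl⟩, hxR⟩
    refine ⟨x, ⟨hx, hkR x (u x) ?_⟩, rfl⟩
    rw [← norm_toE3_sq]
    exact pow_le_pow_left₀ (norm_nonneg _) (by simpa using hxR) 2
  calc μH[2] (((fun x => toE3 x (u x)) '' Ω) ∩ Metric.closedBall (0 : E3) R)
      ≤ μH[2] ((fun x => toE3 x (u x)) '' U) := measure_mono hsub
    _ ≤ ENNReal.ofReal (4 / π * (1 + 1 / 100) ^ 3) *
        ∫⁻ x in U, ENNReal.ofReal (√(1 + ‖gradient u x‖ ^ 2)) :=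
        hausdorffMeasure_graph_le hUopen (hu.mono fun x hx => hx.1)
          (harea.trans_lt ENNReal.ofReal_lt_top).ne (by norm_num)
    _ ≤ ENNReal.ofReal (4 / π * (1 + 1 / 100) ^ 3) * ENNReal.ofReal (9 / 4 * π * R ^ 2) := by
        gcongr
    _ ≤ ENNReal.ofReal (3 * π * R ^ 2) := by
        rw [← ENNReal.ofReal_mul (by positivity)]
        refine ENNReal.ofReal_le_ofReal ?_
        have h1 : 4 / π * (1 + 1 / 100) ^ 3 * (9 / 4 * π * R ^ 2) =
            9 * (1 + 1 / 100) ^ 3 * R ^ 2 := by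
          field_simp
        have h2 : 9 * (1 + 1 / 100 : ℝ) ^ 3 ≤ 3 * π := by
          have := Real.pi_gt_d2
          norm_num
          linarith
        rw [h1]
        gcongr
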